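/- Let n ≥ 1 be an integer, W : ℝ² → ℝ nonnegative, measurable and bounded with ∫_{ℝ²} W = 1, and let u > 0, T > 0. Then, with the conventions s₀ = 0 and x₀ = y, ∫_{ℝ²} ρ_{2u}(y) [ ∫_{0 < s₁ < ⋯ < s_n < T} ∫_{(ℝ²)^n} ∏_{i=1}^{n} W(x_i) ρ_{2(s_i − s_{i−1})}(x_{i−1} − x_i) dx₁⋯dx_n ds₁⋯ds_n ] dy ≤ (2π)^{−n} ∫_{0 < s₁ < ⋯ < s_n < T} (2(s_n + u))^{−1} ∏_{i=1}^{n−1} min( 1/(2(s_{i+1} − s_i)) + 1/(2(s_i + u)), 2π‖W‖_∞ ) ds₁⋯ds_n. -/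

import Mathlib

open MeasureTheory Real

/-- The two-dimensional heat kernel `ρ_t(x) = (2πt)⁻¹ exp(−|x|²/(2t))`. -/
noncomputable def heatK (t : ℝ) (x : EuclideanSpace ℝ (Fin 2)) : ℝ :=
  (2 * π * t)⁻¹ * Real.exp (-‖x‖ ^ 2 / (2 * t))


abbrev EE := EuclideanSpace ℝ (Fin 2)

lemma heatK_nonneg {t : ℝ} (ht : 0 < t) (x : EE) : 0 ≤ heatK t x := by
  unfold heatK; positivity

lemma heatK_le {t : ℝ} (ht : 0 < t) (x : EE) : heatK t x ≤ (2 * π * t)⁻¹ := by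
  unfold heatK
  have h1 : Real.exp (-‖x‖ ^ 2 / (2 * t)) ≤ 1 := by
    apply Real.exp_le_one_iff.mpr
    rw [neg_div]
    have : 0 ≤ ‖x‖ ^ 2 / (2 * t) := by positivity
    linarith
  have h2 : 0 ≤ (2 * π * t)⁻¹ := by positivity
  nlinarith

lemma heatK_mul {a b : ℝ} (ha : 0 < a) (hb : 0 < b) (x z : EE) :
    heatK a x * heatK b (x - z) =
      heatK (a + b) z * heatK (a * b / (a + b)) (x - (a / (a + b)) • z) := by
  unfold heatK
  have hab : 0 < a + b := by positivity
  rw [mul_mul_mul_comm (2 * π * a)⁻¹, mul_mul_mul_comm (2 * π * (a + b))⁻¹, ← Real.exp_add, ← Real.exp_add]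
  congr 1
  · field_simp
  · congr 1
    rw [norm_sub_sq_real, norm_sub_sq_real, inner_smul_right, norm_smul, Real.norm_of_nonneg (by positivity)]
    field_simp
    ring

lemma lintegral_heatK {t : ℝ} (ht : 0 < t) : ∫⁻ x, ‖heatK t x‖ₑ = 1 := by
  have hi : ∫ x : EE, heatK t x = 1 := by
    unfold heatK
    rw [integral_const_mul]
    have := GaussianFourier.integral_rexp_neg_mul_sq_norm (V := EE) (b := (2 * t)⁻¹) (by positivity)
    simp only [finrank_euclideanSpace, Fintype.card_fin] at this
    have e : ∀ x : EE, -‖x‖ ^ 2 / (2 * t) = -(2 * t)⁻¹ * ‖x‖ ^ 2 := by intro x; field_simp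
    simp_rw [e]
    rw [this]
    norm_num
    field_simp
  have hint : Integrable (fun x : EE => heatK t x) := by
    by_contra h
    rw [integral_undef h] at hi
    norm_num at hi
  rw [← ofReal_integral_norm_eq_lintegral_enorm hint]
  simp_rw [Real.norm_of_nonneg (heatK_nonneg ht _)]
  rw [hi]; simp

lemma measurable_heatK : Measurable (fun p : ℝ × EE => heatK p.1 p.2) := by
  unfold heatK; fun_prop

lemma meas_cons {α : Type*} [MeasurableSpace α] (n : ℕ) (j : Fin (n+1)) :
    Measurable (fun p : α × (Fin n → α) => (Fin.cons p.1 p.2 : Fin (n+1) → α) j) := by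
  refine Fin.cases ?_ (fun i => ?_) j
  · simp only [Fin.cons_zero]; fun_prop
  · simp only [Fin.cons_succ]; fun_prop

lemma lintegral_pi_succ (n : ℕ) (f : (Fin (n+1) → EE) → ENNReal) (hf : Measurable f) :
    ∫⁻ X, f X = ∫⁻ x : EE, ∫⁻ Y : Fin n → EE, f (Fin.cons x Y : Fin (n+1) → EE) := by
  have h := (volume_preserving_piFinSuccAbove (fun _ : Fin (n+1) => EE) 0).symm
  rw [← h.lintegral_comp_emb (MeasurableEquiv.measurableEmbedding _) f]
  rw [Measure.volume_eq_prod, lintegral_prod]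
  · simp [MeasurableEquiv.piFinSuccAbove, Fin.insertNthEquiv]
  · exact (hf.comp (MeasurableEquiv.measurable _)).aemeasurable

/-- One-step estimate. -/
lemma step_bound (W : EE → ℝ) (M : ℝ) (hW0 : ∀ z, 0 ≤ W z) (hM : ∀ z, W z ≤ M)
    (hWm : Measurable W)
    (hW1 : ∫⁻ z, ‖W z‖ₑ = 1) {a b : ℝ} (ha : 0 < a) (hb : 0 < b) (z : EE) :
    ∫⁻ x, ‖W x‖ₑ * ‖heatK a x‖ₑ * ‖heatK b (x - z)‖ₑ ≤
      ENNReal.ofReal ((2 * π)⁻¹ * min (1 / b + 1 / a) (2 * π * M)) * ‖heatK (a + b) z‖ₑ := by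
  have hM0 : 0 ≤ M := (hW0 0).trans (hM 0)
  have hc : 0 < a * b / (a + b) := by positivity
  have e : ∀ x, ‖W x‖ₑ * ‖heatK a x‖ₑ * ‖heatK b (x - z)‖ₑ =
      ‖heatK (a + b) z‖ₑ * (‖W x‖ₑ * ‖heatK (a * b / (a + b)) (x - (a / (a + b)) • z)‖ₑ) := by
    intro x
    rw [mul_assoc, ← enorm_mul, heatK_mul ha hb, enorm_mul]; ring
  have hmh : ∀ t, Measurable (fun x : EE => heatK t x) := fun t =>
    measurable_heatK.comp (by fun_prop : Measurable (fun x : EE => (t, x)))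
  have hm2 : Measurable (fun x => heatK (a * b / (a + b)) (x - (a / (a + b)) • z)) :=
    (hmh _).comp (by fun_prop)
  simp_rw [e]
  rw [lintegral_const_mul _ (by fun_prop), mul_comm]
  gcongr
  rw [mul_min_of_nonneg _ _ (by positivity), ENNReal.ofReal_min]
  apply le_min
  · calc _ ≤ ∫⁻ x, ‖W x‖ₑ * ENNReal.ofReal ((2 * π)⁻¹ * (1 / b + 1 / a)) := by
          gcongr with x
          rw [Real.enorm_of_nonneg (heatK_nonneg hc _)]
          apply ENNReal.ofReal_le_ofReal
          refine (heatK_le hc _).trans (le_of_eq ?_)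
          field_simp
      _ = _ := by rw [lintegral_mul_const _ (by fun_prop), hW1, one_mul]
  · calc _ ≤ ∫⁻ x, ENNReal.ofReal ((2 * π)⁻¹ * (2 * π * M)) *
            ‖heatK (a * b / (a + b)) (x - (a / (a + b)) • z)‖ₑ := by
          gcongr with x
          rw [Real.enorm_of_nonneg (hW0 _)]
          apply ENNReal.ofReal_le_ofReal
          refine (hM x).trans (le_of_eq ?_)
          field_simp
      _ = _ := by
          rw [lintegral_const_mul _ (by fun_prop),
            lintegral_sub_right_eq_self (fun x => ‖heatK (a * b / (a + b)) x‖ₑ),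
            lintegral_heatK hc, mul_one]

lemma first_bound {a b : ℝ} (ha : 0 < a) (hb : 0 < b) (z : EE) :
    ∫⁻ x, ‖heatK a x‖ₑ * ‖heatK b (x - z)‖ₑ = ‖heatK (a + b) z‖ₑ := by
  have hc : 0 < a * b / (a + b) := by positivity
  have hmh : ∀ t, Measurable (fun x : EE => heatK t x) := fun t =>
    measurable_heatK.comp (by fun_prop : Measurable (fun x : EE => (t, x)))
  have hm2 : Measurable (fun x => heatK (a * b / (a + b)) (x - (a / (a + b)) • z)) :=
    (hmh _).comp (by fun_prop)
  simp_rw [← enorm_mul, heatK_mul ha hb, enorm_mul]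
  rw [lintegral_const_mul _ (by fun_prop),
            lintegral_sub_right_eq_self (fun x => ‖heatK (a * b / (a + b)) x‖ₑ),
            lintegral_heatK hc, mul_one]

/-- The chain of kernels. -/
noncomputable def GG (W : EE → ℝ) (n : ℕ) (s : Fin (n+1) → ℝ) (x : EE) (X : Fin n → EE) : ENNReal :=
  ∏ i : Fin n, ‖W (X i)‖ₑ * ‖heatK (2 * (s i.succ - s i.castSucc))
    ((Fin.cons x X : Fin (n+1) → EE) i.castSucc - (Fin.cons x X : Fin (n+1) → EE) i.succ)‖ₑ

lemma measurable_GG (W : EE → ℝ) (hWm : Measurable W) (n : ℕ) :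
    Measurable (fun p : (Fin (n+1) → ℝ) × EE × (Fin n → EE) => GG W n p.1 p.2.1 p.2.2) := by
  unfold GG
  refine Finset.measurable_prod _ (fun i _ => ?_)
  have h1 : ∀ j : Fin (n+1), Measurable (fun p : (Fin (n+1) → ℝ) × EE × (Fin n → EE) =>
      (Fin.cons p.2.1 p.2.2 : Fin (n+1) → EE) j) := fun j =>
    (meas_cons n j).comp measurable_snd
  have h2 : Measurable (fun p : (Fin (n+1) → ℝ) × EE × (Fin n → EE) =>
      heatK (2 * (p.1 i.succ - p.1 i.castSucc))
        ((Fin.cons p.2.1 p.2.2 : Fin (n+1) → EE) i.castSucc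
          - (Fin.cons p.2.1 p.2.2 : Fin (n+1) → EE) i.succ)) := by
    refine measurable_heatK.comp (Measurable.prodMk ?_ ((h1 _).sub (h1 _)))
    fun_prop
  have h3 : Measurable (fun p : (Fin (n+1) → ℝ) × EE × (Fin n → EE) => W (p.2.2 i)) :=
    hWm.comp (by fun_prop)
  exact h3.enorm.mul h2.enorm

lemma measurable_GG_pair (W : EE → ℝ) (hWm : Measurable W) (n : ℕ) (s : Fin (n+1) → ℝ) :
    Measurable (fun p : EE × (Fin n → EE) => GG W n s p.1 p.2) := by
  have h1 : Measurable (fun p : EE × (Fin n → EE) => (s, p)) := measurable_prodMk_left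
  have h := (measurable_GG W hWm n).comp h1
  simp only [Function.comp_def] at h
  exact h

lemma measurable_GG_right (W : EE → ℝ) (hWm : Measurable W) (n : ℕ) (s : Fin (n+1) → ℝ) (x : EE) :
    Measurable (fun X : Fin n → EE => GG W n s x X) := by
  have h1 : Measurable (fun p : (Fin n → EE) => (x, p)) := measurable_prodMk_left
  have h := (measurable_GG_pair W hWm n s).comp h1
  simp only [Function.comp_def] at h
  exact h

lemma GG_succ (W : EE → ℝ) (n : ℕ) (s : Fin (n+2) → ℝ) (x z : EE) (Y : Fin n → EE) :
    GG W (n+1) s x (Fin.cons z Y : Fin (n+1) → EE) =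
      ‖W z‖ₑ * ‖heatK (2 * (s 1 - s 0)) (x - z)‖ₑ * GG W n (fun i => s i.succ) z Y := by
  unfold GG
  rw [Fin.prod_univ_succ]
  rfl

lemma reduce (W : EE → ℝ) (hWm : Measurable W) (n : ℕ) (s : Fin (n+2) → ℝ)
    (h k : EE → ENNReal) (hh : Measurable h)
    (hk : ∀ z, ∫⁻ x, h x * ‖heatK (2 * (s 1 - s 0)) (x - z)‖ₑ ≤ k z) :
    ∫⁻ x, ∫⁻ X, h x * GG W (n+1) s x X ≤
      ∫⁻ z, k z * (‖W z‖ₑ * ∫⁻ Y, GG W n (fun i => s i.succ) z Y) := by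
  have mG : Measurable (fun p : EE × (Fin n → EE) => GG W n (fun i => s i.succ) p.1 p.2) :=
    measurable_GG_pair W hWm n _
  have mG1 : ∀ z, Measurable (fun Y : Fin n → EE => GG W n (fun i => s i.succ) z Y) := fun z =>
    measurable_GG_right W hWm n _ z
  have mG' : ∀ x, Measurable (fun X : Fin (n+1) → EE => GG W (n+1) s x X) := fun x =>
    measurable_GG_right W hWm (n+1) _ x
  have mI : Measurable (fun z => ∫⁻ Y, GG W n (fun i => s i.succ) z Y) :=
    mG.lintegral_prod_right'
  have mH : Measurable (fun p : EE × EE => heatK (2 * (s 1 - s 0)) (p.1 - p.2)) :=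
    measurable_heatK.comp
      (by fun_prop : Measurable (fun p : EE × EE => ((2 * (s 1 - s 0)), p.1 - p.2)))
  have e : ∀ x, ∫⁻ X, h x * GG W (n+1) s x X =
      ∫⁻ z, (h x * ‖heatK (2 * (s 1 - s 0)) (x - z)‖ₑ) *
        (‖W z‖ₑ * ∫⁻ Y, GG W n (fun i => s i.succ) z Y) := by
    intro x
    rw [lintegral_pi_succ _ _ ((mG' x).const_mul _)]
    refine lintegral_congr (fun z => ?_)
    simp_rw [GG_succ]
    rw [← mul_assoc (_ * _) (‖W z‖ₑ), ← lintegral_const_mul _ (mG1 z)]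
    refine lintegral_congr (fun Y => ?_)
    ring
  simp_rw [e]
  rw [lintegral_lintegral_swap]
  · refine lintegral_mono (fun z => ?_)
    dsimp only
    rw [lintegral_mul_const]
    · gcongr
      exact hk z
    · exact hh.mul (mH.comp (by fun_prop : Measurable (fun x : EE => (x, z)))).enorm
  · refine Measurable.aemeasurable ?_
    exact ((hh.comp measurable_fst).mul mH.enorm).mul
      ((hWm.comp measurable_snd).enorm.mul (mI.comp measurable_snd))

/-- The temporal bound. -/
noncomputable def BB (M u : ℝ) (n : ℕ) (s : Fin (n+1) → ℝ) : ℝ :=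
  (2 * (s (Fin.last n) + u))⁻¹ * ∏ i : Fin n,
    min (1 / (2 * (s i.succ - s i.castSucc)) + 1 / (2 * (s i.castSucc + u))) (2 * π * M)

lemma BB_succ (M u : ℝ) (n : ℕ) (s : Fin (n+2) → ℝ) :
    BB M u (n+1) s = min (1 / (2 * (s 1 - s 0)) + 1 / (2 * (s 0 + u))) (2 * π * M) *
      BB M u n (fun i => s i.succ) := by
  unfold BB
  rw [Fin.prod_univ_succ]
  have : s (Fin.last (n+1)) = s (Fin.last n).succ := rfl
  rw [this, mul_left_comm]
  rfl

lemma chain (W : EE → ℝ) (M u : ℝ) (hW0 : ∀ z, 0 ≤ W z) (hM : ∀ z, W z ≤ M)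
    (hWm : Measurable W) (hW1 : ∫⁻ z, ‖W z‖ₑ = 1) (n : ℕ) :
    ∀ s : Fin (n+1) → ℝ, StrictMono s → 0 < s 0 + u →
    ∫⁻ z, ‖heatK (2 * (s 0 + u)) z‖ₑ * (‖W z‖ₑ * ∫⁻ X, GG W n s z X) ≤
      ENNReal.ofReal ((2 * π)⁻¹ ^ (n+1) * BB M u n s) := by
  have hM0 : 0 ≤ M := (hW0 0).trans (hM 0)
  induction n with
  | zero =>
    intro s hs hu
    have hu2 : 0 < 2 * (s 0 + u) := by linarith
    simp only [GG, BB, Finset.univ_eq_empty, Finset.prod_empty, lintegral_one, mul_one]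
    have : (volume : Measure (Fin 0 → EE)) Set.univ = 1 := by
      rw [volume_pi, Measure.pi_univ]; simp
    rw [this]
    calc _ ≤ ∫⁻ z, ENNReal.ofReal ((2 * π * (2 * (s 0 + u)))⁻¹) * ‖W z‖ₑ := by
          simp only [mul_one]
          gcongr with z
          · rw [Real.enorm_of_nonneg (heatK_nonneg hu2 _)]
            exact ENNReal.ofReal_le_ofReal (heatK_le hu2 _)
      _ = _ := by
          rw [lintegral_const_mul _ hWm.enorm, hW1, mul_one]
          congr 1
          rw [mul_inv]; simp
  | succ n ih =>
    intro s hs hu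
    have h01 : s 0 < s 1 := hs (by simp)
    have ha : 0 < 2 * (s 0 + u) := by linarith
    have hb : 0 < 2 * (s 1 - s 0) := by linarith
    have mh : Measurable (fun x : EE => heatK (2 * (s 0 + u)) x) :=
      measurable_heatK.comp (by fun_prop : Measurable (fun x : EE => (2 * (s 0 + u), x)))
    have mG' : ∀ x, Measurable (fun X : Fin (n+1) → EE => GG W (n+1) s x X) := fun x =>
      measurable_GG_right W hWm (n+1) _ x
    set c := ENNReal.ofReal ((2 * π)⁻¹ *
      min (1 / (2 * (s 1 - s 0)) + 1 / (2 * (s 0 + u))) (2 * π * M)) with hc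
    have e : ∀ z, ‖heatK (2 * (s 0 + u)) z‖ₑ * (‖W z‖ₑ * ∫⁻ X, GG W (n+1) s z X) =
        ∫⁻ X, (‖W z‖ₑ * ‖heatK (2 * (s 0 + u)) z‖ₑ) * GG W (n+1) s z X := by
      intro z
      rw [lintegral_const_mul _ (mG' z)]; ring
    simp_rw [e]
    have r := reduce W hWm n s (fun z => ‖W z‖ₑ * ‖heatK (2 * (s 0 + u)) z‖ₑ)
      (fun z => c * ‖heatK (2 * (s 1 + u)) z‖ₑ) (hWm.enorm.mul mh.enorm) (fun z => by
        have := step_bound W M hW0 hM hWm hW1 ha hb z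
        rwa [show 2 * (s 0 + u) + 2 * (s 1 - s 0) = 2 * (s 1 + u) by ring] at this)
    refine r.trans ?_
    simp_rw [mul_assoc c]
    rw [lintegral_const_mul' _ _ (by simp [hc])]
    have i := ih (fun i => s i.succ) (fun i j hij => hs (by simpa using hij))
      (by change 0 < s 1 + u; linarith)
    refine (mul_le_mul_right i c).trans (le_of_eq ?_)
    have hmin : 0 ≤ min (1 / (2 * (s 1 - s 0)) + 1 / (2 * (s 0 + u))) (2 * π * M) := by
      apply le_min <;> positivity
    rw [hc, ← ENNReal.ofReal_mul (by positivity), BB_succ]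
    congr 1
    ring

lemma total (W : EE → ℝ) (M u : ℝ) (hu : 0 < u) (hW0 : ∀ z, 0 ≤ W z) (hM : ∀ z, W z ≤ M)
    (hWm : Measurable W) (hW1 : ∫⁻ z, ‖W z‖ₑ = 1) (n : ℕ)
    (σ : Fin (n+1) → ℝ) (hs : StrictMono σ) (h0 : 0 < σ 0) :
    ∫⁻ y, ‖heatK (2 * u) y‖ₑ * ∫⁻ X, GG W (n+1) (Fin.cons 0 σ : Fin (n+2) → ℝ) y X ≤
      ENNReal.ofReal ((2 * π)⁻¹ ^ (n+1) * BB M u n σ) := by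
  have mh : Measurable (fun x : EE => heatK (2 * u) x) :=
      measurable_heatK.comp (by fun_prop : Measurable (fun x : EE => (2 * u, x)))
  have mG' : ∀ x, Measurable (fun X : Fin (n+1) → EE =>
      GG W (n+1) (Fin.cons 0 σ : Fin (n+2) → ℝ) x X) := fun x =>
      measurable_GG_right W hWm (n+1) _ x
  simp_rw [← lintegral_const_mul _ (mG' _)]
  refine (reduce W hWm n (Fin.cons 0 σ : Fin (n+2) → ℝ) _
    (fun z => ‖heatK (2 * (σ 0 + u)) z‖ₑ) mh.enorm (fun z => ?_)).trans ?_
  · have : 2 * ((Fin.cons 0 σ : Fin (n+2) → ℝ) 1 - (Fin.cons 0 σ : Fin (n+2) → ℝ) 0) = 2 * σ 0 := by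
      change 2 * (σ 0 - 0) = _
      ring
    rw [this, first_bound (by positivity) (by positivity)]
    apply le_of_eq
    congr 2; ring
  · exact chain W M u hW0 hM hWm hW1 n σ hs (by linarith)

lemma enorm_finset_prod {n : ℕ} (f : Fin n → ℝ) : ‖∏ i, f i‖ₑ = ∏ i, ‖f i‖ₑ := by
  induction n with
  | zero => simp
  | succ n ih => rw [Fin.prod_univ_succ, Fin.prod_univ_succ, enorm_mul, ih]

lemma measurableSet_simplex (n : ℕ) (T : ℝ) :
    MeasurableSet {σ : Fin (n+1) → ℝ | StrictMono σ ∧ 0 < σ 0 ∧ σ (Fin.last n) < T} := by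
  refine MeasurableSet.inter ?_ (MeasurableSet.inter ?_ ?_)
  · have : {σ : Fin (n+1) → ℝ | StrictMono σ} =
        ⋂ i : Fin (n+1), ⋂ j : Fin (n+1), ⋂ _ : i < j, {σ | σ i < σ j} := by
      ext σ; simp [StrictMono]
    change MeasurableSet {σ : Fin (n+1) → ℝ | StrictMono σ}
    rw [this]
    refine MeasurableSet.iInter fun i => MeasurableSet.iInter fun j => MeasurableSet.iInter fun _ => ?_
    exact measurableSet_lt (measurable_pi_apply i) (measurable_pi_apply j)
  · exact measurableSet_lt measurable_const (measurable_pi_apply 0)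
  · exact measurableSet_lt (measurable_pi_apply _) measurable_const

lemma BB_min_nonneg (M u : ℝ) (hu : 0 < u) (hM0 : 0 ≤ M) (n : ℕ) (σ : Fin (n+1) → ℝ)
    (hs : StrictMono σ) (h0 : 0 < σ 0) (i : Fin n) :
    0 ≤ min (1 / (2 * (σ i.succ - σ i.castSucc)) + 1 / (2 * (σ i.castSucc + u))) (2 * π * M) := by
  have h1 : σ i.castSucc < σ i.succ := hs (Fin.castSucc_lt_succ)
  have h2 : σ 0 ≤ σ i.castSucc := hs.monotone (Fin.zero_le _)
  have h3 : 0 < σ i.succ - σ i.castSucc := by linarith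
  have h4 : 0 < σ i.castSucc + u := by linarith
  apply le_min <;> positivity

lemma BB_nonneg (M u : ℝ) (hu : 0 < u) (hM0 : 0 ≤ M) (n : ℕ) (σ : Fin (n+1) → ℝ)
    (hs : StrictMono σ) (h0 : 0 < σ 0) : 0 ≤ BB M u n σ := by
  have h2 : σ 0 ≤ σ (Fin.last n) := hs.monotone (Fin.zero_le _)
  have h4 : 0 < σ (Fin.last n) + u := by linarith
  exact mul_nonneg (by positivity)
    (Finset.prod_nonneg fun i _ => BB_min_nonneg M u hu hM0 n σ hs h0 i)

lemma BB_le (M u : ℝ) (hu : 0 < u) (hM0 : 0 ≤ M) (n : ℕ) (σ : Fin (n+1) → ℝ)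
    (hs : StrictMono σ) (h0 : 0 < σ 0) : BB M u n σ ≤ (2 * u)⁻¹ * (2 * π * M) ^ n := by
  have h2 : σ 0 ≤ σ (Fin.last n) := hs.monotone (Fin.zero_le _)
  unfold BB
  have hp : ∏ i : Fin n, min (1 / (2 * (σ i.succ - σ i.castSucc)) + 1 / (2 * (σ i.castSucc + u)))
      (2 * π * M) ≤ (2 * π * M) ^ n := by
    refine (Finset.prod_le_prod (fun i _ => BB_min_nonneg M u hu hM0 n σ hs h0 i)
      (fun i _ => min_le_right _ _)).trans ?_
    simp
  refine mul_le_mul ?_ hp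
    (Finset.prod_nonneg fun i _ => BB_min_nonneg M u hu hM0 n σ hs h0 i) (by positivity)
  apply inv_anti₀ (by positivity)
  linarith

lemma integrable_BB (M u T : ℝ) (hu : 0 < u) (hM0 : 0 ≤ M) (n : ℕ) :
    Integrable (Set.indicator {σ : Fin (n+1) → ℝ | StrictMono σ ∧ 0 < σ 0 ∧ σ (Fin.last n) < T}
      (BB M u n)) := by
  rw [integrable_indicator_iff (measurableSet_simplex n T)]
  have mB : Measurable (BB M u n) := by
    unfold BB
    refine Measurable.mul (by fun_prop) (Finset.measurable_prod _ fun i _ => ?_)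
    refine Measurable.min ?_ measurable_const
    fun_prop
  refine Measure.integrableOn_of_bounded (M := (2 * u)⁻¹ * (2 * π * M) ^ n) ?_
    mB.aestronglyMeasurable ?_
  · have hsub : {σ : Fin (n+1) → ℝ | StrictMono σ ∧ 0 < σ 0 ∧ σ (Fin.last n) < T} ⊆
        Set.Icc (fun _ => 0) (fun _ => T) := by
      rintro σ ⟨hs, h0, hT⟩
      refine ⟨fun i => ?_, fun i => ?_⟩
      · exact h0.le.trans (hs.monotone (Fin.zero_le i))
      · exact (hs.monotone (Fin.le_last i)).trans hT.le
    exact ((measure_mono hsub).trans_lt isCompact_Icc.measure_lt_top).ne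
  · rw [ae_restrict_iff' (measurableSet_simplex n T)]
    refine Filter.Eventually.of_forall fun σ hσ => ?_
    rw [Real.norm_of_nonneg (BB_nonneg M u hu hM0 n σ hσ.1 hσ.2.1)]
    exact BB_le M u hu hM0 n σ hσ.1 hσ.2.1

lemma measurable_J (W : EE → ℝ) (hWm : Measurable W) (n : ℕ) :
    Measurable (fun p : EE × (Fin (n+1) → ℝ) =>
      ∫⁻ X, GG W (n+1) (Fin.cons 0 p.2 : Fin (n+2) → ℝ) p.1 X) := by
  have hc : Measurable (fun q : (EE × (Fin (n+1) → ℝ)) × (Fin (n+1) → EE) =>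
      (Fin.cons 0 q.1.2 : Fin (n+2) → ℝ)) := by
    refine measurable_pi_lambda _ fun j => ?_
    refine Fin.cases ?_ (fun i => ?_) j
    · simp only [Fin.cons_zero]; fun_prop
    · simp only [Fin.cons_succ]; fun_prop
  have h1 : Measurable (fun q : (EE × (Fin (n+1) → ℝ)) × (Fin (n+1) → EE) =>
      ((Fin.cons 0 q.1.2 : Fin (n+2) → ℝ), q.1.1, q.2)) :=
    hc.prodMk (measurable_fst.fst.prodMk measurable_snd)
  have h := (measurable_GG W hWm (n+1)).comp h1
  simp only [Function.comp_def] at h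
  exact h.lintegral_prod_right'

/-- The spatial integrals in the `(n+1)`-st chaos term of the conditional variance
(stated with `n+1` variables so that the number of variables is an arbitrary integer
`≥ 1`) are reduced to a purely temporal simplex integral; conventions `s₀ = 0`,
`x₀ = y` are implemented by `Fin.cons`. -/
theorem stmt10 (n : ℕ) (W : EuclideanSpace ℝ (Fin 2) → ℝ)
    (hW0 : ∀ z, 0 ≤ W z) (hWmeas : Measurable W)
    (hWbdd : ∃ M : ℝ, ∀ z, W z ≤ M) (hWint : ∫ z, W z = 1)
    (u T : ℝ) (hu : 0 < u) (hT : 0 < T) :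
    (∫ y : EuclideanSpace ℝ (Fin 2), heatK (2 * u) y *
      ∫ σ : Fin (n+1) → ℝ,
        Set.indicator {σ : Fin (n+1) → ℝ | StrictMono σ ∧ 0 < σ 0 ∧ σ (Fin.last n) < T}
          (fun σ => ∫ X : Fin (n+1) → EuclideanSpace ℝ (Fin 2),
            ∏ i : Fin (n+1),
              W (X i) *
                heatK (2 * ((Fin.cons 0 σ : Fin (n+2) → ℝ) i.succ
                          - (Fin.cons 0 σ : Fin (n+2) → ℝ) i.castSucc))
                  ((Fin.cons y X : Fin (n+2) → EuclideanSpace ℝ (Fin 2)) i.castSucc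
                    - (Fin.cons y X : Fin (n+2) → EuclideanSpace ℝ (Fin 2)) i.succ)) σ)
    ≤ (2 * π) ^ (-(n+1 : ℤ)) *
      ∫ σ : Fin (n+1) → ℝ,
        Set.indicator {σ : Fin (n+1) → ℝ | StrictMono σ ∧ 0 < σ 0 ∧ σ (Fin.last n) < T}
          (fun σ => (2 * (σ (Fin.last n) + u))⁻¹ *
            ∏ i : Fin n,
              min (1 / (2 * (σ i.succ - σ i.castSucc)) + 1 / (2 * (σ i.castSucc + u)))
                (2 * π * ⨆ z, W z)) σ := by
  set S : Set (Fin (n+1) → ℝ) :=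
    {σ : Fin (n+1) → ℝ | StrictMono σ ∧ 0 < σ 0 ∧ σ (Fin.last n) < T} with hS
  have mS : MeasurableSet S := measurableSet_simplex n T
  set M := ⨆ z, W z with hMdef
  have hM : ∀ z, W z ≤ M := by
    obtain ⟨K, hK⟩ := hWbdd
    exact fun z => le_ciSup (f := W) ⟨K, by rintro _ ⟨w, rfl⟩; exact hK w⟩ z
  have hM0 : 0 ≤ M := (hW0 0).trans (hM 0)
  have hWi : Integrable W := by
    by_contra h
    rw [integral_undef h] at hWint
    norm_num at hWint
  have hW1 : ∫⁻ z, ‖W z‖ₑ = 1 := by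
    rw [← ofReal_integral_norm_eq_lintegral_enorm hWi]
    simp_rw [Real.norm_of_nonneg (hW0 _)]
    rw [hWint]; simp
  have hpow : (2 * π) ^ (-(n+1 : ℤ)) = (2 * π)⁻¹ ^ (n+1) := by
    rw [zpow_neg, inv_pow]
    norm_cast
  have hB0 : ∀ σ, 0 ≤ S.indicator (BB M u n) σ := fun σ =>
    Set.indicator_nonneg (fun σ hσ => BB_nonneg M u hu hM0 n σ hσ.1 hσ.2.1) σ
  have hBi : Integrable (S.indicator (BB M u n)) := integrable_BB M u T hu hM0 n
  change _ ≤ (2 * π) ^ (-(n+1 : ℤ)) * ∫ σ, S.indicator (BB M u n) σ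
  rw [hpow, ← integral_const_mul]
  refine (le_abs_self _).trans ?_
  rw [← ENNReal.ofReal_le_ofReal_iff (integral_nonneg fun σ => mul_nonneg (by positivity) (hB0 σ)),
    ← Real.norm_eq_abs, ofReal_norm,
    ofReal_integral_eq_lintegral_ofReal (hBi.const_mul _)
      (Filter.Eventually.of_forall fun σ => mul_nonneg (by positivity) (hB0 σ))]
  refine (enorm_integral_le_lintegral_enorm _).trans ?_
  have hle : ∀ y : EE, ‖heatK (2 * u) y *
      ∫ σ : Fin (n+1) → ℝ, S.indicator
          (fun σ => ∫ X : Fin (n+1) → EuclideanSpace ℝ (Fin 2),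
            ∏ i : Fin (n+1),
              W (X i) *
                heatK (2 * ((Fin.cons 0 σ : Fin (n+2) → ℝ) i.succ
                          - (Fin.cons 0 σ : Fin (n+2) → ℝ) i.castSucc))
                  ((Fin.cons y X : Fin (n+2) → EuclideanSpace ℝ (Fin 2)) i.castSucc
                    - (Fin.cons y X : Fin (n+2) → EuclideanSpace ℝ (Fin 2)) i.succ)) σ‖ₑ ≤
      ‖heatK (2 * u) y‖ₑ * ∫⁻ σ, S.indicator
        (fun σ => ∫⁻ X, GG W (n+1) (Fin.cons 0 σ : Fin (n+2) → ℝ) y X) σ := by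
    intro y
    rw [enorm_mul]
    gcongr
    refine (enorm_integral_le_lintegral_enorm _).trans ?_
    refine lintegral_mono (fun σ => ?_)
    rw [enorm_indicator_eq_indicator_enorm]
    refine Set.indicator_le_indicator ?_
    refine (enorm_integral_le_lintegral_enorm _).trans ?_
    refine lintegral_mono (fun X => ?_)
    unfold GG
    dsimp only
    rw [enorm_finset_prod]
    simp_rw [enorm_mul]
    exact le_rfl
  refine (lintegral_mono hle).trans ?_
  have mJ := measurable_J W hWmeas n
  have mJ2 : Measurable (fun p : EE × (Fin (n+1) → ℝ) => S.indicator
      (fun σ => ∫⁻ X, GG W (n+1) (Fin.cons 0 σ : Fin (n+2) → ℝ) p.1 X) p.2) := by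
    have := mJ.indicator (measurable_snd mS : MeasurableSet (Prod.snd ⁻¹' S))
    exact this
  have mJ3 : ∀ y, Measurable (fun σ : Fin (n+1) → ℝ => S.indicator
      (fun σ => ∫⁻ X, GG W (n+1) (Fin.cons 0 σ : Fin (n+2) → ℝ) y X) σ) := fun y =>
    mJ2.comp (measurable_prodMk_left (x := y))
  have mh : Measurable (fun x : EE => heatK (2 * u) x) :=
      measurable_heatK.comp (by fun_prop : Measurable (fun x : EE => (2 * u, x)))
  simp_rw [← lintegral_const_mul _ (mJ3 _)]
  rw [lintegral_lintegral_swap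
    ((mh.enorm.comp measurable_fst).mul mJ2).aemeasurable]
  refine lintegral_mono (fun σ => ?_)
  dsimp only
  by_cases hσ : σ ∈ S
  · simp only [Set.indicator_of_mem hσ]
    exact total W M u hu hW0 hM hWmeas hW1 n σ hσ.1 hσ.2.1
  · simp [Set.indicator_of_notMem hσ]
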